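/- Let L be a one-way PTC-logic with one modality. Then the quantified modal logic QL is complete with respect to predicate neighbourhood frames with constant domain: there is a class C of predicate neighbourhood frames with constant domain such that QL equals the set of modal predicate formulas valid on every member of C; equivalently, every modal predicate formula not belonging to QL is refuted in some predicate neighbourhood model with constant domain whose underlying frame validates QL. -/

import Mathlib

open Classical

noncomputable section

/- ### Propositional modal formulas -/

/-- Propositional modal formulas: `⊥`, letters, `→`, `□`. -/
inductive MF : Type
  | falsum : MF
  | prop : ℕ → MF
  | impl : MF → MF → MF
  | box : MF → MF

def negMF (A : MF) : MF := .impl A .falsum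
def diaMF (A : MF) : MF := negMF (.box (negMF A))

/-- `□^k A`. -/
def boxIter : ℕ → MF → MF
  | 0, A => A
  | k+1, A => boxIter k (.box A)

/-- the one-way PTC axiom `□p → □^k p`. -/
def ptcAxiom (k : ℕ) : MF := .impl (.box (.prop 0)) (boxIter k (.prop 0))

/-- a formula is closed if it contains no propositional letters. -/
def ClosedMF : MF → Prop
  | .falsum => True
  | .prop _ => False
  | .impl A B => ClosedMF A ∧ ClosedMF B
  | .box A => ClosedMF A

/- ### Kripke semantics -/

def ksat {W : Type} (R : W → W → Prop) (V : ℕ → Set W) : W → MF → Prop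
  | _, .falsum => False
  | x, .prop n => x ∈ V n
  | x, .impl A B => ksat R V x A → ksat R V x B
  | x, .box A => ∀ y, R x y → ksat R V y A

/-- the logic of a Kripke frame: all formulas valid on it. -/
def KLog {W : Type} (R : W → W → Prop) : Set MF := {A | ∀ V x, ksat R V x A}

/-- p-morphism of Kripke frames. -/
def IsPMorphismK {W U : Type} (R : W → W → Prop) (S : U → U → Prop) (f : W → U) : Prop :=
  Function.Surjective f ∧
  (∀ w v, R w v → S (f w) (f v)) ∧
  (∀ w u', S (f w) u' → ∃ v, R w v ∧ f v = u')

/- ### Neighbourhood semantics -/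

def nbsat {X : Type} (τ : X → Filter X) (V : ℕ → Set X) : X → MF → Prop
  | _, .falsum => False
  | x, .prop n => x ∈ V n
  | x, .impl A B => nbsat τ V x A → nbsat τ V x B
  | x, .box A => ∃ U ∈ τ x, ∀ y ∈ U, nbsat τ V y A

def NLog {X : Type} (τ : X → Filter X) : Set MF := {A | ∀ V x, nbsat τ V x A}

/-- the neighbourhood frame `N(F)` of a Kripke frame: the filter of supersets of `R(w)`. -/
def nbhdOf {W : Type} (R : W → W → Prop) : W → Filter W :=
  fun w => Filter.principal {u | R w u}

/-- p-morphism of neighbourhood frames. -/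
def IsPMorphismN {X Y : Type} (τ : X → Filter X) (σ : Y → Filter Y) (f : X → Y) : Prop :=
  Function.Surjective f ∧
  (∀ x, ∀ U ∈ τ x, f '' U ∈ σ (f x)) ∧
  (∀ x, ∀ V ∈ σ (f x), f ⁻¹' V ∈ τ x)

/- ### Rootedness and unravelling -/

/-- every point is reachable from `w0`. -/
def IsRootedAt {W : Type} (R : W → W → Prop) (w0 : W) : Prop :=
  ∀ w, Relation.ReflTransGen R w0 w

/-- the set of rooted paths of `(W, R)` with root `w0`. -/
def Unravel (W : Type) (R : W → W → Prop) (w0 : W) : Type :=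
  {l : List W // l.head? = some w0 ∧ l.Chain' R}

/-- `π` : the last point of a rooted path. -/
def Unravel.last {W : Type} {R : W → W → Prop} {w0 : W} (p : Unravel W R w0) : W :=
  p.1.getLast (fun h => by have h1 := p.2.1; rw [h] at h1; simp at h1)

/-- the relation `R^♯` of the unravelling: one-step extension of paths. -/
def RSharp {W : Type} (R : W → W → Prop) (w0 : W) (p q : Unravel W R w0) : Prop :=
  ∃ v, q.1 = p.1 ++ [v] ∧ R p.last v

/- ### Pseudo-infinite paths with stops -/

/-- `st(α)`: the length of the prefix before the infinite tail of zeros. -/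
def stOf {A : Type} (α : ℕ → Option A) : ℕ :=
  sInf {m | ∀ k, m ≤ k → α k = none}

/-- the zero-free part of an eventually-zero sequence. -/
def zf {A : Type} (α : ℕ → Option A) : List A :=
  (List.range (stOf α)).filterMap α

/-- `W_ω`: pseudo-infinite paths with stops (zeros encoded as `none`). -/
def Wom (W : Type) (R : W → W → Prop) (w0 : W) : Type :=
  {α : ℕ → Option W //
    (∃ m, ∀ k, m ≤ k → α k = none) ∧ (w0 :: zf α).Chain' R}

/-- `f₀` maps a pseudo-infinite path to its zero-free rooted path. -/
def fzero {W : Type} {R : W → W → Prop} {w0 : W} (α : Wom W R w0) : Unravel W R w0 :=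
  ⟨w0 :: zf α.1, rfl, α.2.2⟩

/-- the basic neighbourhoods `U_k(α)`. -/
def Uk {W : Type} {R : W → W → Prop} {w0 : W} (k : ℕ) (α : Wom W R w0) :
    Set (Wom W R w0) :=
  {β | (∀ i, i < max k (stOf α.1) → α.1 i = β.1 i) ∧ RSharp R w0 (fzero α) (fzero β)}

/-- the neighbourhood function of `N_ω(F)`: the filter generated by `{U_n(α) : n ∈ ℕ}`. -/
def tauOm {W : Type} (R : W → W → Prop) (w0 : W) (α : Wom W R w0) :
    Filter (Wom W R w0) :=
  ⨅ n : ℕ, Filter.principal (Uk n α)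

/- ### Entanglement -/

def leftW {W1 W2 : Type} (l : List (W1 ⊕ W2)) : List W1 :=
  l.filterMap (Sum.elim some fun _ => none)

def rightW {W1 W2 : Type} (l : List (W1 ⊕ W2)) : List W2 :=
  l.filterMap (Sum.elim (fun _ => none) some)

/-- the entanglement `F₁ ⋈ F₂`: words whose two projections (with roots prefixed)
are rooted paths. -/
def Ent {W1 W2 : Type} (R1 : W1 → W1 → Prop) (x0 : W1)
    (R2 : W2 → W2 → Prop) (y0 : W2) : Set (List (W1 ⊕ W2)) :=
  {x | (x0 :: leftW x).Chain' R1 ∧ (y0 :: rightW x).Chain' R2}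

/-- `x ∼ y` iff `x = t·c`, `y = t·d` with `t` in the entanglement, `c, d ∈ W₁*`. -/
def SimRel {W1 W2 : Type} (R1 : W1 → W1 → Prop) (x0 : W1)
    (R2 : W2 → W2 → Prop) (y0 : W2) (x y : List (W1 ⊕ W2)) : Prop :=
  ∃ t ∈ Ent R1 x0 R2 y0, ∃ c d : List W1,
    x = t ++ c.map Sum.inl ∧ y = t ++ d.map Sum.inl

/-- the `∼`-class `[x]` (within the entanglement). -/
def simCls {W1 W2 : Type} (R1 : W1 → W1 → Prop) (x0 : W1)
    (R2 : W2 → W2 → Prop) (y0 : W2) (x : List (W1 ⊕ W2)) : Set (List (W1 ⊕ W2)) :=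
  {y | y ∈ Ent R1 x0 R2 y0 ∧ SimRel R1 x0 R2 y0 x y}

/-- `D'_a`: elements of the entanglement whose first projection is `a`. -/
def Dprime {W1 W2 : Type} (R1 : W1 → W1 → Prop) (x0 : W1)
    (R2 : W2 → W2 → Prop) (y0 : W2) (a : Unravel W1 R1 x0) : Set (List (W1 ⊕ W2)) :=
  {x | x ∈ Ent R1 x0 R2 y0 ∧ x0 :: leftW x = a.1}

/-- `D^♯_a = {[x] : x ∈ D'_a}`. -/
def Dsharp {W1 W2 : Type} (R1 : W1 → W1 → Prop) (x0 : W1)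
    (R2 : W2 → W2 → Prop) (y0 : W2) (a : Unravel W1 R1 x0) :
    Set (Set (List (W1 ⊕ W2))) :=
  {S | ∃ x ∈ Dprime R1 x0 R2 y0 a, S = simCls R1 x0 R2 y0 x}

/-- `ℝ ∖ {0}`. -/
def Rnz : Type := {r : ℝ // r ≠ 0}

def y0R : Rnz := ⟨1, one_ne_zero⟩

/-- the total relation on `ℝ ∖ {0}` (the continuum S5 frame). -/
def TotR : Rnz → Rnz → Prop := fun _ _ => True

/- ### Predicate modal formulas and semantics -/

/-- Modal predicate formulas; `pred k n args` is the `k`-th `n`-ary predicate letter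
applied to the variables `args`; variables are named by natural numbers. -/
inductive PF : Type
  | falsum : PF
  | pred : ℕ → (n : ℕ) → (Fin n → ℕ) → PF
  | impl : PF → PF → PF
  | box : PF → PF
  | all : ℕ → PF → PF

def negPF (A : PF) : PF := .impl A .falsum
def exPF (x : ℕ) (A : PF) : PF := negPF (.all x (negPF A))

/-- satisfaction in a predicate Kripke model with expanding domains,
relative to an assignment `env` of elements to variables. -/
def pksat {W D : Type} (R : W → W → Prop) (Dom : W → Set D)
    (ξ : ℕ → (n : ℕ) → W → (Fin n → D) → Prop) :
    (ℕ → D) → W → PF → Prop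
  | _, _, .falsum => False
  | env, u, .pred k n args => ξ k n u (fun i => env (args i))
  | env, u, .impl A B => pksat R Dom ξ env u A → pksat R Dom ξ env u B
  | env, u, .box A => ∀ v, R u v → pksat R Dom ξ env v A
  | env, u, .all x A => ∀ a ∈ Dom u, pksat R Dom ξ (Function.update env x a) u A

/-- satisfaction in a predicate neighbourhood model with constant domain `Dstar`. -/
def pnsat {X Dstar : Type} (τ : X → Filter X)
    (θ : ℕ → (n : ℕ) → X → (Fin n → Dstar) → Prop) :
    (ℕ → Dstar) → X → PF → Prop
  | _, _, .falsum => False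
  | env, x, .pred k n args => θ k n x (fun i => env (args i))
  | env, x, .impl A B => pnsat τ θ env x A → pnsat τ θ env x B
  | env, x, .box A => ∃ U ∈ τ x, ∀ y ∈ U, pnsat τ θ env y A
  | env, x, .all v A => ∀ a : Dstar, pnsat τ θ (Function.update env v a) x A

/-- p-morphism of predicate Kripke frames with expanding domains:
a p-morphism of frames together with a compatible family of surjections between
the domains (encoded as total maps on the domain carriers). -/
def IsPredKPMorph {W W' D D' : Type} (R : W → W → Prop) (R' : W' → W' → Prop)
    (Dom : W → Set D) (Dom' : W' → Set D')
    (f : W → W') (g : W → D → D') : Prop :=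
  IsPMorphismK R R' f ∧
  (∀ w, Set.MapsTo (g w) (Dom w) (Dom' (f w))) ∧
  (∀ w, Set.SurjOn (g w) (Dom w) (Dom' (f w))) ∧
  (∀ w w', R w w' → ∀ d ∈ Dom w, g w d = g w' d)

/-- p-morphism from a predicate neighbourhood frame with constant domain `Dstar`
to a predicate Kripke frame with expanding domains. -/
def IsPredNPMorph {X W Dstar D : Type} (τ : X → Filter X)
    (R : W → W → Prop) (Dom : W → Set D)
    (f : X → W) (g : X → Dstar → D) : Prop :=
  IsPMorphismN τ (nbhdOf R) f ∧
  (∀ x (d : Dstar), g x d ∈ Dom (f x)) ∧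
  (∀ x, ∀ e ∈ Dom (f x), ∃ d : Dstar, g x d = e) ∧
  (∀ (d : Dstar) (x : X), ∃ U ∈ τ x, ∀ y ∈ U, g y d = g x d)

/- ### The map h -/

/-- fuel-driven version of the interleaving map `h`:
a nonzero letter of `γ` is emitted; a zero of `γ` consumes (and emits, unless it
is a zero) one letter of `α`. -/
def hAux {W A : Type} : ℕ → (ℕ → Option W) → (ℕ → Option A) → List (W ⊕ A)
  | 0, _, _ => []
  | n+1, α, γ =>
    match γ 0 with
    | some c => Sum.inr c :: hAux n α (fun i => γ (i+1))
    | none =>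
      match α 0 with
      | some a => Sum.inl a :: hAux n (fun i => α (i+1)) (fun i => γ (i+1))
      | none => hAux n (fun i => α (i+1)) (fun i => γ (i+1))

/-- the map `h : W_ω × ℝ_ω → (W ∪ ℝ∖{0})*`. -/
def hfun {W : Type} {R : W → W → Prop} {w0 : W}
    (α : Wom W R w0) (γ : Wom Rnz TotR y0R) : List (W ⊕ Rnz) :=
  hAux (stOf α.1 + stOf γ.1) α.1 γ.1

/- ### Normal modal logics -/

def substMF (σ : ℕ → MF) : MF → MF
  | .falsum => .falsum
  | .prop n => σ n
  | .impl A B => .impl (substMF σ A) (substMF σ B)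
  | .box A => .box (substMF σ A)

def beval (v : ℕ → Prop) (b : MF → Prop) : MF → Prop
  | .falsum => False
  | .prop n => v n
  | .impl A B => beval v b A → beval v b B
  | .box A => b A

/-- classical propositional tautology (boxed formulas treated as atoms). -/
def TautMF (A : MF) : Prop := ∀ v b, beval v b A

/-- derivability in the minimal normal modal logic with extra axioms `Ax`. -/
inductive KDer (Ax : Set MF) : MF → Prop
  | ax {A : MF} : A ∈ Ax → KDer Ax A
  | taut {A : MF} : TautMF A → KDer Ax A
  | normality (A B : MF) :
      KDer Ax (.impl (.box (.impl A B)) (.impl (.box A) (.box B)))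
  | mp {A B : MF} : KDer Ax (.impl A B) → KDer Ax A → KDer Ax B
  | nec {A : MF} : KDer Ax A → KDer Ax (.box A)
  | subst {A : MF} (σ : ℕ → MF) : KDer Ax A → KDer Ax (substMF σ A)

/-- the axioms `□p → □^k p` for `k ∈ K`. -/
def ptcAxiomSet (K : Set ℕ) : Set MF := {A | ∃ k ∈ K, A = ptcAxiom k}

/- ### Universal strict Horn sentences -/

/-- quantifier-free positive formulas in the signature of one binary relation. -/
inductive PosF : Type
  | atom : ℕ → ℕ → PosF
  | conj : PosF → PosF → PosF
  | disj : PosF → PosF → PosF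

def PosF.sat {V : Type} (S : V → V → Prop) (env : ℕ → V) : PosF → Prop
  | .atom i j => S (env i) (env j)
  | .conj A B => PosF.sat S env A ∧ PosF.sat S env B
  | .disj A B => PosF.sat S env A ∨ PosF.sat S env B

/-- a universal strict Horn sentence `∀ ... (φ → R x y)`. -/
structure Horn : Type where
  hyp : PosF
  cx : ℕ
  cy : ℕ

def Horn.Holds {V : Type} (φ : Horn) (S : V → V → Prop) : Prop :=
  ∀ env : ℕ → V, PosF.sat S env φ.hyp → S (env φ.cx) (env φ.cy)

/-- the `Γ`-closure `S^Γ`: the least relation containing `S` and validating `Γ`. -/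
def hornClosure {V : Type} (Γ : Set Horn) (S : V → V → Prop) : V → V → Prop :=
  fun a b => ∀ T : V → V → Prop,
    (∀ x y, S x y → T x y) → (∀ φ ∈ Γ, φ.Holds T) → T a b

/-- a Horn sentence corresponds to the axiom `□p → □^k p` if it defines exactly the
frames validating that axiom. -/
def Corresponds (φ : Horn) (k : ℕ) : Prop :=
  ∀ (V : Type) (S : V → V → Prop),
    φ.Holds S ↔ ∀ (Val : ℕ → Set V) (x : V), ksat S Val x (ptcAxiom k)

/-- `U^Γ_k(α)`. -/
def UkG {W : Type} {R : W → W → Prop} {w0 : W} (Γ : Set Horn) (k : ℕ)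
    (α : Wom W R w0) : Set (Wom W R w0) :=
  {β | (∀ i, i < max k (stOf α.1) → α.1 i = β.1 i) ∧
        hornClosure Γ (RSharp R w0) (fzero α) (fzero β)}

/-- the neighbourhood function of `N^Γ_ω(F)`. -/
def tauG {W : Type} (R : W → W → Prop) (w0 : W) (Γ : Set Horn)
    (α : Wom W R w0) : Filter (Wom W R w0) :=
  ⨅ n : ℕ, Filter.principal (UkG Γ n α)

/- ### Quantified modal logic QL -/

/-- substitution of predicate formulas for the letters of a propositional formula. -/
def psubst (σ : ℕ → PF) : MF → PF
  | .falsum => .falsum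
  | .prop n => σ n
  | .impl A B => .impl (psubst σ A) (psubst σ B)
  | .box A => .box (psubst σ A)

def FreeIn (x : ℕ) : PF → Prop
  | .falsum => False
  | .pred _ _ args => ∃ i, args i = x
  | .impl A B => FreeIn x A ∨ FreeIn x B
  | .box A => FreeIn x A
  | .all z A => z ≠ x ∧ FreeIn x A

/-- substitution of variable `y` for the free occurrences of variable `x`. -/
def subV (x y : ℕ) : PF → PF
  | .falsum => .falsum
  | .pred k n args => .pred k n (fun i => if args i = x then y else args i)
  | .impl A B => .impl (subV x y A) (subV x y B)
  | .box A => .box (subV x y A)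
  | .all z A => if z = x then .all z A else .all z (subV x y A)

/-- `y` is substitutable for `x` (no capture). -/
def FreeFor (y x : ℕ) : PF → Prop
  | .falsum => True
  | .pred _ _ _ => True
  | .impl A B => FreeFor y x A ∧ FreeFor y x B
  | .box A => FreeFor y x A
  | .all z A => x = z ∨ ((z = y → ¬ FreeIn x A) ∧ FreeFor y x A)

/-- derivability in the minimal predicate modal logic `QL` over the propositional
logic axiomatized by `Ax`. -/
inductive QLDer (Ax : Set MF) : PF → Prop
  | propInst {A : MF} (σ : ℕ → PF) : KDer Ax A → QLDer Ax (psubst σ A)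
  | allElim (x y : ℕ) (A : PF) (h : FreeFor y x A) :
      QLDer Ax (.impl (.all x A) (subV x y A))
  | allShift (x : ℕ) (A B : PF) (h : ¬ FreeIn x B) :
      QLDer Ax (.impl (.all x (.impl B A)) (.impl B (.all x A)))
  | exShift (x : ℕ) (A B : PF) (h : ¬ FreeIn x B) :
      QLDer Ax (.impl (.all x (.impl A B)) (.impl (exPF x A) B))
  | mp {A B : PF} : QLDer Ax (.impl A B) → QLDer Ax A → QLDer Ax B
  | nec {A : PF} : QLDer Ax A → QLDer Ax (.box A)
  | gen {A : PF} (x : ℕ) : QLDer Ax A → QLDer Ax (.all x A)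

/-- a predicate neighbourhood frame with constant domain. -/
structure PredNFrame : Type 1 where
  X : Type
  tau : X → Filter X
  D : Type
  hD : Nonempty D

/-- validity of a predicate formula (i.e. of its universal closure) on a predicate
neighbourhood frame with constant domain. -/
def PredNFrame.Valid (F : PredNFrame) (A : PF) : Prop :=
  ∀ (θ : ℕ → (n : ℕ) → F.X → (Fin n → F.D) → Prop) (env : ℕ → F.D) (x : F.X),
    pnsat F.tau θ env x A

end

namespace QLCompleteness

/- ### Syntax -/

/-- all bound variables are smaller than `N`. -/
def BoundLt (N : ℕ) : PF → Prop
  | .falsum => True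
  | .pred _ _ _ => True
  | .impl A B => BoundLt N A ∧ BoundLt N B
  | .box A => BoundLt N A
  | .all z A => z < N ∧ BoundLt N A

/-- naive simultaneous substitution of variables for the free variables. -/
def simSub (e : ℕ → ℕ) : PF → PF
  | .falsum => .falsum
  | .pred k n args => .pred k n (fun i => e (args i))
  | .impl A B => .impl (simSub e A) (simSub e B)
  | .box A => .box (simSub e A)
  | .all z A => .all z (simSub (Function.update e z z) A)

theorem BoundLt.mono {N M : ℕ} (h : N ≤ M) {A : PF} (hA : BoundLt N A) : BoundLt M A := by
  induction A with
  | falsum => trivial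
  | pred => trivial
  | impl A B ihA ihB => exact ⟨ihA hA.1, ihB hA.2⟩
  | box A ih => exact ih hA
  | all z A ih => exact ⟨lt_of_lt_of_le hA.1 h, ih hA.2⟩

theorem exists_boundLt (A : PF) : ∃ N, BoundLt N A := by
  induction A with
  | falsum => exact ⟨0, trivial⟩
  | pred => exact ⟨0, trivial⟩
  | impl A B ihA ihB =>
    obtain ⟨n, hn⟩ := ihA
    obtain ⟨m, hm⟩ := ihB
    exact ⟨max n m, hn.mono (le_max_left _ _), hm.mono (le_max_right _ _)⟩
  | box A ih => exact ih
  | all z A ih =>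
    obtain ⟨n, hn⟩ := ih
    exact ⟨max n (z + 1), by omega, hn.mono (le_max_left _ _)⟩

theorem exists_freeIn_lt (A : PF) : ∃ N, ∀ v, FreeIn v A → v < N := by
  induction A with
  | falsum => exact ⟨0, fun v h => h.elim⟩
  | pred k n args =>
    refine ⟨(Finset.univ.sup args) + 1, ?_⟩
    rintro v ⟨i, rfl⟩
    exact Nat.lt_succ_of_le (Finset.le_sup (f := args) (Finset.mem_univ i))
  | impl A B ihA ihB =>
    obtain ⟨n, hn⟩ := ihA
    obtain ⟨m, hm⟩ := ihB
    refine ⟨max n m, ?_⟩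
    rintro v (h | h)
    · exact lt_of_lt_of_le (hn v h) (le_max_left _ _)
    · exact lt_of_lt_of_le (hm v h) (le_max_right _ _)
  | box A ih => exact ih
  | all z A ih =>
    obtain ⟨n, hn⟩ := ih
    exact ⟨n, fun v h => hn v h.2⟩

theorem simSub_congr {A : PF} : ∀ {e e' : ℕ → ℕ}, (∀ v, FreeIn v A → e v = e' v) →
    simSub e A = simSub e' A := by
  induction A with
  | falsum => intros; rfl
  | pred k n args =>
    intro e e' h
    simp only [simSub]
    congr 1
    funext i
    exact h _ ⟨i, rfl⟩
  | impl A B ihA ihB =>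
    intro e e' h
    simp only [simSub]
    rw [ihA fun v hv => h v (Or.inl hv), ihB fun v hv => h v (Or.inr hv)]
  | box A ih =>
    intro e e' h
    simp only [simSub]
    rw [ih fun v hv => h v hv]
  | all z A ih =>
    intro e e' h
    simp only [simSub]
    congr 1
    refine ih fun v hv => ?_
    by_cases hz : v = z
    · simp [hz]
    · simp [Function.update_of_ne hz, h v ⟨fun h => hz h.symm, hv⟩]

theorem simSub_id (A : PF) : simSub id A = A := by
  induction A with
  | falsum => rfl
  | pred => rfl
  | impl A B ihA ihB => simp only [simSub, ihA, ihB]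
  | box A ih => simp only [simSub, ih]
  | all z A ih =>
    have : Function.update (id : ℕ → ℕ) z z = id := Function.update_eq_self z id
    simp only [simSub, this, ih]

theorem subV_simSub {x d : ℕ} {A : PF} : ∀ {e : ℕ → ℕ}, (∀ y, y ≠ x → e y ≠ x) →
    subV x d (simSub (Function.update e x x) A) = simSub (Function.update e x d) A := by
  induction A with
  | falsum => intros; rfl
  | pred k n args =>
    intro e h
    simp only [simSub, subV]
    congr 1
    funext i
    by_cases hi : args i = x
    · simp [hi]
    · simp [Function.update_of_ne hi, h _ hi]
  | impl A B ihA ihB =>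
    intro e h
    simp only [simSub, subV, ihA h, ihB h]
  | box A ih =>
    intro e h
    simp only [simSub, subV, ih h]
  | all z A ih =>
    intro e h
    simp only [simSub, subV]
    split_ifs with hz
    · subst hz
      simp
    · rw [Function.update_comm (Ne.symm hz), Function.update_comm (Ne.symm hz), ih]
      intro y hy
      by_cases hyz : y = z
      · subst hyz
        simpa using hy
      · rw [Function.update_of_ne hyz]
        exact h y hy

theorem subV_self (x : ℕ) (A : PF) : subV x x A = A := by
  have h := subV_simSub (x := x) (d := x) (A := A) (e := id) (fun y hy => hy)
  rwa [show Function.update (id : ℕ → ℕ) x x = id from Function.update_eq_self x id,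
    simSub_id] at h

theorem freeIn_simSub {v : ℕ} {A : PF} : ∀ {e : ℕ → ℕ}, FreeIn v (simSub e A) →
    ∃ y, FreeIn y A ∧ e y = v := by
  induction A with
  | falsum => intro e h; exact h.elim
  | pred k n args =>
    rintro e ⟨i, rfl⟩
    exact ⟨args i, ⟨i, rfl⟩, rfl⟩
  | impl A B ihA ihB =>
    rintro e (h | h)
    · obtain ⟨y, hy, h⟩ := ihA h
      exact ⟨y, Or.inl hy, h⟩
    · obtain ⟨y, hy, h⟩ := ihB h
      exact ⟨y, Or.inr hy, h⟩
  | box A ih => intro e h; exact ih h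
  | all z A ih =>
    rintro e ⟨hz, h⟩
    obtain ⟨y, hy, h⟩ := ih h
    by_cases hyz : y = z
    · subst hyz
      rw [Function.update_self] at h
      exact (hz h).elim
    · rw [Function.update_of_ne hyz] at h
      exact ⟨y, ⟨fun h => hyz h.symm, hy⟩, h⟩

theorem boundLt_simSub {N : ℕ} {A : PF} : ∀ {e : ℕ → ℕ}, BoundLt N A →
    BoundLt N (simSub e A) := by
  induction A with
  | falsum => intros; trivial
  | pred => intros; trivial
  | impl A B ihA ihB => exact fun h => ⟨ihA h.1, ihB h.2⟩
  | box A ih => exact fun h => ih h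
  | all z A ih => exact fun h => ⟨h.1, ih h.2⟩

theorem boundLt_subV {N x d : ℕ} {A : PF} (hA : BoundLt N A) : BoundLt N (subV x d A) := by
  induction A with
  | falsum => trivial
  | pred => trivial
  | impl A B ihA ihB => exact ⟨ihA hA.1, ihB hA.2⟩
  | box A ih => exact ih hA
  | all z A ih =>
    simp only [subV]
    split_ifs
    · exact hA
    · exact ⟨hA.1, ih hA.2⟩

theorem freeIn_subV {x d v : ℕ} {A : PF} (h : FreeIn v (subV x d A)) :
    v = d ∨ (v ≠ x ∧ FreeIn v A) := by
  induction A with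
  | falsum => exact h.elim
  | pred k n args =>
    obtain ⟨i, hi⟩ := h
    dsimp only at hi
    split_ifs at hi with hx
    · exact Or.inl hi.symm
    · exact Or.inr ⟨hi ▸ hx, i, hi⟩
  | impl A B ihA ihB =>
    rcases h with h | h
    · exact (ihA h).imp_right fun h => ⟨h.1, Or.inl h.2⟩
    · exact (ihB h).imp_right fun h => ⟨h.1, Or.inr h.2⟩
  | box A ih => exact ih h
  | all z A ih =>
    simp only [subV] at h
    split_ifs at h with hz
    · exact Or.inr ⟨fun hv => h.1 (hz.trans hv.symm), h⟩
    · exact (ih h.2).imp_right fun h' => ⟨h'.1, h.1, h'.2⟩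

theorem freeFor_of_boundLt {N d x : ℕ} {A : PF} (hd : N ≤ d) (hA : BoundLt N A) :
    FreeFor d x A := by
  induction A with
  | falsum => trivial
  | pred => trivial
  | impl A B ihA ihB => exact ⟨ihA hA.1, ihB hA.2⟩
  | box A ih => exact ih hA
  | all z A ih =>
    exact Or.inr ⟨fun h => absurd hA.1 (by omega), ih hA.2⟩

theorem freeFor_of_not_freeIn {d x : ℕ} {A : PF} (h : ¬ FreeIn d A) : FreeFor x d A := by
  induction A with
  | falsum => trivial
  | pred => trivial
  | impl A B ihA ihB => exact ⟨ihA fun h' => h (Or.inl h'), ihB fun h' => h (Or.inr h')⟩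
  | box A ih => exact ih h
  | all z A ih =>
    by_cases hz : d = z
    · exact Or.inl hz
    · have : ¬ FreeIn d A := fun h' => h ⟨fun h => hz h.symm, h'⟩
      exact Or.inr ⟨fun _ => this, ih this⟩

theorem freeFor_self (x : ℕ) (A : PF) : FreeFor x x A := by
  induction A with
  | falsum => trivial
  | pred => trivial
  | impl A B ihA ihB => exact ⟨ihA, ihB⟩
  | box A ih => exact ih
  | all z A ih =>
    by_cases hz : x = z
    · exact Or.inl hz
    · exact Or.inr ⟨fun h => (hz h.symm).elim, ih⟩

theorem freeFor_subV {x d : ℕ} {A : PF} (h : ¬ FreeIn d A) :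
    FreeFor x d (subV x d A) := by
  induction A with
  | falsum => trivial
  | pred => trivial
  | impl A B ihA ihB => exact ⟨ihA fun h' => h (Or.inl h'), ihB fun h' => h (Or.inr h')⟩
  | box A ih => exact ih h
  | all z A ih =>
    simp only [subV]
    split_ifs with hz
    · exact freeFor_of_not_freeIn h
    · by_cases hd : d = z
      · exact Or.inl hd
      · exact Or.inr ⟨fun h => (hz h).elim, ih fun h' => h ⟨fun h => hd h.symm, h'⟩⟩

theorem subV_of_not_freeIn {x d : ℕ} {A : PF} (h : ¬ FreeIn d A) : subV d x A = A := by
  induction A with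
  | falsum => rfl
  | pred k n args =>
    simp only [subV]
    congr 1
    funext i
    exact if_neg fun hi => h ⟨i, hi⟩
  | impl A B ihA ihB =>
    simp only [subV, ihA fun h' => h (Or.inl h'), ihB fun h' => h (Or.inr h')]
  | box A ih => simp only [subV, ih h]
  | all z A ih =>
    simp only [subV]
    split_ifs with hz
    · rfl
    · rw [ih fun h' => h ⟨hz, h'⟩]

theorem subV_subV_cancel {N x d : ℕ} {A : PF} (hd : N ≤ d) (hA : BoundLt N A)
    (h : ¬ FreeIn d A) : subV d x (subV x d A) = A := by
  induction A with
  | falsum => rfl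
  | pred k n args =>
    simp only [subV]
    congr 1
    funext i
    by_cases hx : args i = x
    · simp [hx]
    · simp only [if_neg hx]
      exact if_neg fun hi => h ⟨i, hi⟩
  | impl A B ihA ihB =>
    simp only [subV, ihA hA.1 fun h' => h (Or.inl h'), ihB hA.2 fun h' => h (Or.inr h')]
  | box A ih => simp only [subV, ih hA h]
  | all z A ih =>
    have hzd : z ≠ d := fun h => absurd hA.1 (by omega)
    by_cases hz : z = x
    · rw [show subV x d (.all z A) = .all z A by simp only [subV, if_pos hz]]
      exact subV_of_not_freeIn h
    · simp only [subV, if_neg hz, if_neg hzd]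
      rw [ih hA.2 fun h' => h ⟨hzd, h'⟩]

/-- an injective coding of formulas by natural numbers. -/
def code : PF → ℕ
  | .falsum => Nat.pair 0 0
  | .pred k n args => Nat.pair 1 (Nat.pair k (Encodable.encode (List.ofFn (n := n) args)))
  | .impl A B => Nat.pair 2 (Nat.pair (code A) (code B))
  | .box A => Nat.pair 3 (code A)
  | .all z A => Nat.pair 4 (Nat.pair z (code A))

theorem code_injective : Function.Injective code := by
  intro A
  induction A with
  | falsum => intro B h; cases B <;> simp_all [code, Nat.pair_eq_pair]
  | pred k n args =>
    intro B h
    cases B with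
    | pred k' n' args' =>
      simp only [code, Nat.pair_eq_pair, Encodable.encode_inj, true_and] at h
      obtain ⟨rfl, h⟩ := h
      have hn : n = n' := by simpa using congrArg List.length h
      subst hn
      rw [List.ofFn_injective h]
    | _ => simp_all [code, Nat.pair_eq_pair]
  | impl A B ihA ihB =>
    intro B h
    cases B with
    | impl A' B' =>
      simp only [code, Nat.pair_eq_pair, true_and] at h
      rw [ihA h.1, ihB h.2]
    | _ => simp_all [code, Nat.pair_eq_pair]
  | box A ih =>
    intro B h
    cases B with
    | box A' =>
      simp only [code, Nat.pair_eq_pair, true_and] at h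
      rw [ih h]
    | _ => simp_all [code, Nat.pair_eq_pair]
  | all z A ih =>
    intro B h
    cases B with
    | all z' A' =>
      simp only [code, Nat.pair_eq_pair, true_and] at h
      rw [h.1, ih h.2]
    | _ => simp_all [code, Nat.pair_eq_pair]

theorem exists_enumeration : ∃ f : ℕ → PF, Function.Surjective f :=
  haveI : Countable PF := code_injective.countable
  haveI : Nonempty PF := ⟨.falsum⟩
  exists_surjective_nat PF

/- ### Derivability from hypotheses -/

variable {Ax : Set MF}

theorem QLDer.implK (A B : PF) : QLDer Ax (.impl A (.impl B A)) :=
  QLDer.propInst (A := .impl (.prop 0) (.impl (.prop 1) (.prop 0)))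
    (fun n => if n = 0 then A else B) (.taut fun _ _ h _ => h)

theorem QLDer.implS (A B D : PF) : QLDer Ax
    (.impl (.impl A (.impl B D)) (.impl (.impl A B) (.impl A D))) :=
  QLDer.propInst (A := .impl (.impl (.prop 0) (.impl (.prop 1) (.prop 2)))
      (.impl (.impl (.prop 0) (.prop 1)) (.impl (.prop 0) (.prop 2))))
    (fun n => if n = 0 then A else if n = 1 then B else D)
    (.taut fun _ _ h1 h2 h3 => h1 h3 (h2 h3))

theorem QLDer.dne (A : PF) : QLDer Ax (.impl (negPF (negPF A)) A) :=
  QLDer.propInst (A := .impl (negMF (negMF (.prop 0))) (.prop 0))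
    (fun _ => A) (.taut fun _ _ h => not_not.1 h)

theorem QLDer.boxImpl (A B : PF) : QLDer Ax
    (.impl (.box (.impl A B)) (.impl (.box A) (.box B))) :=
  QLDer.propInst (A := .impl (.box (.impl (.prop 0) (.prop 1)))
      (.impl (.box (.prop 0)) (.box (.prop 1))))
    (fun n => if n = 0 then A else B) (.normality _ _)

/-- derivability from a set of hypotheses using modus ponens only. -/
inductive Prov (Ax : Set MF) (Γ : Set PF) : PF → Prop
  | hyp {A : PF} : A ∈ Γ → Prov Ax Γ A
  | thm {A : PF} : QLDer Ax A → Prov Ax Γ A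
  | mp {A B : PF} : Prov Ax Γ (.impl A B) → Prov Ax Γ A → Prov Ax Γ B

theorem Prov.mono {Γ Δ : Set PF} (h : Γ ⊆ Δ) {A : PF} (hA : Prov Ax Γ A) : Prov Ax Δ A := by
  induction hA with
  | hyp h' => exact .hyp (h h')
  | thm h' => exact .thm h'
  | mp _ _ ih1 ih2 => exact .mp ih1 ih2

theorem Prov.of_empty {A : PF} (h : Prov Ax ∅ A) : QLDer Ax A := by
  induction h with
  | hyp h' => exact h'.elim
  | thm h' => exact h'
  | mp _ _ ih1 ih2 => exact .mp ih1 ih2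

theorem Prov.deduction {Γ : Set PF} {A B : PF} (h : Prov Ax (insert A Γ) B) :
    Prov Ax Γ (.impl A B) := by
  induction h with
  | @hyp B h' =>
    rcases h' with rfl | h'
    · exact .mp (.mp (.thm (QLDer.implS B (.impl B B) B)) (.thm (QLDer.implK _ _)))
        (.thm (QLDer.implK _ _))
    · exact .mp (.thm (QLDer.implK _ _)) (.hyp h')
  | thm h' => exact .mp (.thm (QLDer.implK _ _)) (.thm h')
  | mp _ _ ih1 ih2 => exact .mp (.mp (.thm (QLDer.implS _ _ _)) ih1) ih2

theorem Prov.by_contra {Γ : Set PF} {A : PF} (h : Prov Ax (insert (negPF A) Γ) .falsum) :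
    Prov Ax Γ A :=
  .mp (.thm (QLDer.dne A)) h.deduction

theorem QLDer.allImpl (x : ℕ) (A B : PF) : QLDer Ax
    (.impl (.all x (.impl A B)) (.impl (.all x A) (.all x B))) := by
  have elim : ∀ E : PF, QLDer Ax (.impl (.all x E) E) := fun E => by
    have h := QLDer.allElim (Ax := Ax) x x E (freeFor_self x E)
    rwa [subV_self] at h
  have h1 : Prov Ax (insert (.all x A) (insert (.all x (.impl A B)) ∅)) B :=
    .mp (.mp (.thm (elim (.impl A B))) (.hyp (by simp))) (.mp (.thm (elim A)) (.hyp (by simp)))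
  have h2 := h1.deduction.deduction.of_empty
  have h3 := QLDer.mp (.allShift x (.impl (.all x A) B) (.all x (.impl A B)) (fun h => h.1 rfl)) (.gen x h2)
  have h4 := QLDer.allShift (Ax := Ax) x B (.all x A) (fun h => h.1 rfl)
  have h5 : Prov Ax (insert (.all x (.impl A B)) ∅) (.impl (.all x A) (.all x B)) :=
    .mp (.thm h4) (.mp (.thm h3) (.hyp (by simp)))
  exact h5.deduction.of_empty

theorem Prov.gen {Γ : Set PF} {A : PF} {x : ℕ} (hx : ∀ B ∈ Γ, ¬ FreeIn x B)
    (h : Prov Ax Γ A) : Prov Ax Γ (.all x A) := by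
  induction h with
  | @hyp B h' =>
    have h1 : QLDer Ax (.impl B B) := (Prov.hyp (by simp) : Prov Ax (insert B ∅) B).deduction.of_empty
    exact .mp (.thm (.mp (.allShift x B B (hx B h')) (.gen x h1))) (.hyp h')
  | thm h' => exact .thm (.gen x h')
  | mp _ _ ih1 ih2 => exact .mp (.mp (.thm (QLDer.allImpl _ _ _)) ih1) ih2

theorem Prov.box {Γ : Set PF} {A : PF} (h : Prov Ax {B | PF.box B ∈ Γ} A) :
    Prov Ax Γ (.box A) := by
  induction h with
  | hyp h' => exact .hyp h'
  | thm h' => exact .thm (.nec h')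
  | mp _ _ ih1 ih2 => exact .mp (.mp (.thm (QLDer.boxImpl _ _)) ih1) ih2

theorem Prov.iUnion {Γ : ℕ → Set PF} (hΓ : Monotone Γ) {A : PF}
    (h : Prov Ax (⋃ n, Γ n) A) : ∃ n, Prov Ax (Γ n) A := by
  induction h with
  | hyp h' =>
    obtain ⟨n, hn⟩ := Set.mem_iUnion.1 h'
    exact ⟨n, .hyp hn⟩
  | thm h' => exact ⟨0, .thm h'⟩
  | mp _ _ ih1 ih2 =>
    obtain ⟨n, hn⟩ := ih1
    obtain ⟨m, hm⟩ := ih2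
    exact ⟨max n m, .mp (hn.mono (hΓ (le_max_left _ _))) (hm.mono (hΓ (le_max_right _ _)))⟩

/- ### Canonical worlds -/

/-- the individual domain at level `k`; it avoids the variables below `N`. -/
def dom (N k : ℕ) : Set ℕ := {v | N ≤ v ∧ (Nat.unpair v).1 ≤ k}

theorem dom_mono {N k l : ℕ} (h : k ≤ l) : dom N k ⊆ dom N l :=
  fun _ hv => ⟨hv.1, hv.2.trans h⟩

theorem pair_mem_dom {N k m : ℕ} (h : N ≤ m) : Nat.pair k m ∈ dom N k :=
  ⟨h.trans (Nat.right_le_pair k m), by simp⟩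

/-- formulas with bound variables below `N` and free variables in `dom N k`. -/
def Lang (N k : ℕ) : Set PF := {A | BoundLt N A ∧ ∀ v, FreeIn v A → v ∈ dom N k}

theorem Lang_mono {N k l : ℕ} (h : k ≤ l) : Lang N k ⊆ Lang N l :=
  fun _ hA => ⟨hA.1, fun v hv => dom_mono h (hA.2 v hv)⟩

theorem negPF_mem_Lang {N k : ℕ} {A : PF} (h : A ∈ Lang N k) : negPF A ∈ Lang N k :=
  ⟨⟨h.1, trivial⟩, fun v hv => hv.elim (h.2 v) False.elim⟩

theorem subV_mem_Lang {N k x d : ℕ} {A : PF} (h : PF.all x A ∈ Lang N k) (hd : d ∈ dom N k) :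
    subV x d A ∈ Lang N k := by
  refine ⟨boundLt_subV h.1.2, fun v hv => ?_⟩
  rcases freeIn_subV hv with rfl | ⟨h1, h2⟩
  · exact hd
  · exact h.2 v ⟨h1.symm, h2⟩

/-- a maximal consistent set with witnesses, in the language of its level. -/
structure World (Ax : Set MF) (N : ℕ) : Type where
  lev : ℕ
  carrier : Set PF
  lang : carrier ⊆ Lang N lev
  cons : ¬ Prov Ax carrier .falsum
  max : ∀ A ∈ Lang N lev, A ∈ carrier ∨ negPF A ∈ carrier
  henkin : ∀ x B, PF.all x B ∈ Lang N lev → PF.all x B ∉ carrier →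
    ∃ d ∈ dom N lev, negPF (subV x d B) ∈ carrier

/-- consistent sets in the language of level `k + 1` whose new variables are bounded. -/
def Admissible (Ax : Set MF) (N k : ℕ) (Γ : Set PF) : Prop :=
  ¬ Prov Ax Γ .falsum ∧ Γ ⊆ Lang N (k + 1) ∧
    ∃ M, ∀ A ∈ Γ, ∀ v, FreeIn v A → v ∈ dom N k ∨ v < M

theorem Admissible.insert {N k : ℕ} {Γ : Set PF} (h : Admissible Ax N k Γ) {A : PF}
    (hA : A ∈ Lang N (k + 1)) (hc : ¬ Prov Ax (insert A Γ) .falsum) :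
    Admissible Ax N k (insert A Γ) := by
  refine ⟨hc, Set.insert_subset hA h.2.1, ?_⟩
  obtain ⟨M, hM⟩ := h.2.2
  obtain ⟨m, hm⟩ := exists_freeIn_lt A
  refine ⟨Max.max M m, ?_⟩
  rintro B (rfl | hB) v hv
  · exact Or.inr (lt_of_lt_of_le (hm v hv) (le_max_right _ _))
  · exact (hM B hB v hv).imp_right fun h => lt_of_lt_of_le h (le_max_left _ _)

theorem cons_insert_witness {N k d x : ℕ} {Γ : Set PF} {B : PF} (hΓ : Γ ⊆ Lang N k)
    (hx : x < N) (hB : BoundLt N B) (hd : N ≤ d) (hdB : ¬ FreeIn d B)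
    (hdΓ : ∀ A ∈ Γ, ¬ FreeIn d A) (h : Prov Ax (insert (negPF (subV x d B)) Γ) .falsum) :
    Prov Ax Γ (.all x B) := by
  have h1 : Prov Ax Γ (.all d (subV x d B)) := h.by_contra.gen hdΓ
  have h2 := QLDer.allElim (Ax := Ax) d x (subV x d B) (freeFor_subV hdB)
  rw [subV_subV_cancel hd hB hdB] at h2
  refine (Prov.mp (.thm h2) h1).gen fun A hA hxA => ?_
  have := ((hΓ hA).2 x hxA).1
  omega

theorem Admissible.step {N k : ℕ} {Γ : Set PF} (h : Admissible Ax N k Γ) (A : PF) :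
    ∃ Δ, Γ ⊆ Δ ∧ Admissible Ax N k Δ ∧ (A ∈ Lang N (k + 1) → A ∈ Δ ∨ (negPF A ∈ Δ ∧
      ∀ x B, A = .all x B → ∃ d ∈ dom N (k + 1), negPF (subV x d B) ∈ Δ)) := by
  by_cases hA : A ∈ Lang N (k + 1)
  swap
  · exact ⟨Γ, subset_rfl, h, fun h => (hA h).elim⟩
  by_cases hc : Prov Ax (Insert.insert A Γ) .falsum
  swap
  · exact ⟨_, Set.subset_insert _ _, h.insert hA hc, fun _ => Or.inl (Set.mem_insert _ _)⟩
  have hcn : ¬ Prov Ax (Insert.insert (negPF A) Γ) .falsum :=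
    fun hn => h.1 (.mp hc.deduction hn.by_contra)
  have h' := h.insert (negPF_mem_Lang hA) hcn
  by_cases hall : ∃ x B, A = .all x B
  swap
  · exact ⟨_, Set.subset_insert _ _, h', fun _ => Or.inr ⟨Set.mem_insert _ _,
      fun x B hxB => (hall ⟨x, B, hxB⟩).elim⟩⟩
  obtain ⟨x, B, rfl⟩ := hall
  obtain ⟨M, hM⟩ := h'.2.2
  obtain ⟨m, hm⟩ := exists_freeIn_lt B
  set b := Max.max N (Max.max M m) with hb
  have hd : Nat.pair (k + 1) b ∈ dom N (k + 1) := pair_mem_dom (le_max_left _ _)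
  have hbd := Nat.right_le_pair (k + 1) b
  have hdk : Nat.pair (k + 1) b ∉ dom N k := fun hh => by
    have := hh.2
    simp at this
  refine ⟨_, (Set.subset_insert _ _).trans (Set.subset_insert _ _),
    h'.insert (negPF_mem_Lang (subV_mem_Lang hA hd)) fun hw => hcn ?_, fun _ => Or.inr
    ⟨Set.mem_insert_of_mem _ (Set.mem_insert _ _), ?_⟩⟩
  · refine .mp (.hyp (Set.mem_insert _ _)) (cons_insert_witness h'.2.1 hA.1.1 hA.1.2 hd.1 ?_ ?_ hw)
    · intro hf
      have := hm _ hf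
      omega
    · intro E hE hf
      rcases hM E hE _ hf with h1 | h1
      · exact hdk h1
      · omega
  · intro y E hE
    injection hE with h1 h2
    subst h1 h2
    exact ⟨_, hd, Set.mem_insert _ _⟩

theorem exists_world {N k : ℕ} {Γ : Set PF} (hΓ : Γ ⊆ Lang N k) (hc : ¬ Prov Ax Γ .falsum) :
    ∃ w : World Ax N, w.lev = k + 1 ∧ Γ ⊆ w.carrier := by
  obtain ⟨f, hf⟩ := exists_enumeration
  have h0 : Admissible Ax N k Γ :=
    ⟨hc, hΓ.trans (Lang_mono k.le_succ), 0, fun A hA v hv => Or.inl ((hΓ hA).2 v hv)⟩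
  choose next hsub hadm hdec using
    fun (Δ : {Δ // Admissible Ax N k Δ}) (A : PF) => Δ.2.step A
  let S : ℕ → {Δ // Admissible Ax N k Δ} :=
    fun n => Nat.rec ⟨Γ, h0⟩ (fun i Δ => ⟨next Δ (f i), hadm Δ (f i)⟩) n
  have hmono : Monotone fun n => (S n).1 := monotone_nat_of_le_succ fun n => hsub (S n) (f n)
  have hle : ∀ n, (S n).1 ⊆ ⋃ n, (S n).1 := fun n => Set.subset_iUnion (fun n => (S n).1) n
  have hdec' : ∀ A ∈ Lang N (k + 1), A ∈ (⋃ n, (S n).1) ∨ (negPF A ∈ (⋃ n, (S n).1) ∧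
      ∀ x B, A = .all x B → ∃ d ∈ dom N (k + 1), negPF (subV x d B) ∈ (⋃ n, (S n).1)) := by
    intro A hA
    obtain ⟨n, rfl⟩ := hf A
    refine (hdec (S n) (f n) hA).imp (fun h => hle (n + 1) h) fun h =>
      ⟨hle (n + 1) h.1, fun x B hB => ?_⟩
    obtain ⟨d, hd, h'⟩ := h.2 x B hB
    exact ⟨d, hd, hle (n + 1) h'⟩
  refine ⟨⟨k + 1, ⋃ n, (S n).1, Set.iUnion_subset fun n => (S n).2.2.1, fun h => ?_,
    fun A hA => (hdec' A hA).imp_right And.left, fun x B hL hB => ?_⟩, rfl, hle 0⟩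
  · obtain ⟨n, hn⟩ := Prov.iUnion hmono h
    exact (S n).2.1 hn
  · exact ((hdec' _ hL).resolve_left hB).2 x B rfl

namespace World

variable {N : ℕ} (w : World Ax N)

theorem mem_of_prov {A : PF} (hA : A ∈ Lang N w.lev) (h : Prov Ax w.carrier A) :
    A ∈ w.carrier :=
  (w.max A hA).resolve_right fun hn => w.cons (.mp (.hyp hn) h)

theorem not_mem_of_neg {A : PF} (h : negPF A ∈ w.carrier) : A ∉ w.carrier :=
  fun hA => w.cons (.mp (.hyp h) (.hyp hA))

theorem impl_mem_iff {A B : PF} (hA : A ∈ Lang N w.lev) (hB : B ∈ Lang N w.lev) :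
    PF.impl A B ∈ w.carrier ↔ (A ∈ w.carrier → B ∈ w.carrier) := by
  constructor
  · exact fun h h' => w.mem_of_prov hB (.mp (.hyp h) (.hyp h'))
  · intro h
    refine w.mem_of_prov ⟨⟨hA.1, hB.1⟩, fun v hv => hv.elim (hA.2 v) (hB.2 v)⟩ (.deduction ?_)
    rcases w.max A hA with h' | h'
    · exact .hyp (Set.mem_insert_of_mem _ (h h'))
    · exact Prov.by_contra (.mp (A := A)
        (.hyp (Set.mem_insert_of_mem _ (Set.mem_insert_of_mem _ h')))
        (.hyp (Set.mem_insert_of_mem _ (Set.mem_insert _ _))))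

theorem all_mem_iff {x : ℕ} {B : PF} (hB : PF.all x B ∈ Lang N w.lev) :
    PF.all x B ∈ w.carrier ↔ ∀ d ∈ dom N w.lev, subV x d B ∈ w.carrier := by
  constructor
  · exact fun h d hd => w.mem_of_prov (subV_mem_Lang hB hd)
      (.mp (.thm (.allElim x d B (freeFor_of_boundLt hd.1 hB.1.2))) (.hyp h))
  · intro h
    by_contra hn
    obtain ⟨d, hd, h'⟩ := w.henkin x B hB hn
    exact w.not_mem_of_neg h' (h d hd)

/-- the canonical accessibility relation. -/
def Rel (w v : World Ax N) : Prop :=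
  w.lev ≤ v.lev ∧ ∀ A, PF.box A ∈ w.carrier → A ∈ v.carrier

theorem box_mem_iff {B : PF} (hB : B ∈ Lang N w.lev) :
    PF.box B ∈ w.carrier ↔ ∀ v, Rel w v → B ∈ v.carrier := by
  constructor
  · exact fun h v hv => hv.2 B h
  · intro h
    by_contra hn
    have hc : ¬ Prov Ax (insert (negPF B) {A | PF.box A ∈ w.carrier}) .falsum :=
      fun hp => hn (w.mem_of_prov hB hp.by_contra.box)
    have hsubL : {A | PF.box A ∈ w.carrier} ⊆ Lang N w.lev := fun A hA =>
      (w.lang hA : PF.box A ∈ Lang N w.lev)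
    obtain ⟨v, hv, hsub⟩ := exists_world (Set.insert_subset (negPF_mem_Lang hB) hsubL) hc
    refine v.not_mem_of_neg (hsub (Set.mem_insert _ _)) (h v ⟨by omega, fun A hA => ?_⟩)
    exact hsub (Set.mem_insert_of_mem _ hA)

end World

/-- `k`-fold composition of a relation. -/
def relIter {W : Type} (R : W → W → Prop) : ℕ → W → W → Prop
  | 0 => fun w v => w = v
  | k + 1 => fun w v => ∃ u, relIter R k w u ∧ R u v

theorem mem_of_boxIter_mem {N : ℕ} {σ : ℕ → PF} {k : ℕ} : ∀ {A : MF} {w v : World Ax N},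
    relIter World.Rel k w v → psubst σ (boxIter k A) ∈ w.carrier → psubst σ A ∈ v.carrier := by
  induction k with
  | zero =>
    rintro A w _ rfl h
    exact h
  | succ k ih =>
    rintro A w v ⟨u, hu, huv⟩ h
    exact huv.2 _ (ih (A := .box A) hu h)

theorem Lang_psubst_boxIter {N l : ℕ} {σ : ℕ → PF} {k : ℕ} : ∀ {A : MF},
    psubst σ A ∈ Lang N l → psubst σ (boxIter k A) ∈ Lang N l := by
  induction k with
  | zero => exact fun h => h
  | succ k ih => exact fun h => ih (A := .box _) h

theorem rel_of_relIter {N k : ℕ} (hk : ptcAxiom k ∈ Ax) {w v : World Ax N}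
    (h : relIter World.Rel k w v) : World.Rel w v := by
  constructor
  · clear hk
    induction k generalizing v with
    | zero => rw [show w = v from h]
    | succ k ih =>
      obtain ⟨u, hu, huv⟩ := h
      exact (ih hu).trans huv.1
  · intro A hA
    refine mem_of_boxIter_mem (σ := fun _ => A) (A := .prop 0) h (w.mem_of_prov ?_ ?_)
    · exact Lang_psubst_boxIter (A := .prop 0) (w.lang hA : PF.box A ∈ Lang N w.lev)
    · exact .mp (.thm (.propInst (A := ptcAxiom k) (fun _ => A) (.ax hk))) (.hyp hA)

/- ### The neighbourhood frame -/

/-- a canonical world together with a record of levels bounded by, and attaining, its level. -/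
def Point (Ax : Set MF) (N : ℕ) : Type :=
  {p : World Ax N × (ℕ → ℕ) // (∀ i, p.2 i ≤ p.1.lev) ∧ ∃ i, p.2 i = p.1.lev}

/-- points over accessible worlds whose record has the same first `n` entries. -/
def near {N : ℕ} (n : ℕ) (x y : Point Ax N) : Prop :=
  (∀ i < n, y.1.2 i = x.1.2 i) ∧ World.Rel x.1.1 y.1.1

theorem near_anti {N n m : ℕ} (h : n ≤ m) {x y : Point Ax N} (hxy : near m x y) : near n x y :=
  ⟨fun i hi => hxy.1 i (hi.trans_le h), hxy.2⟩

/-- the filter generated by the sets `{y | near n x y}`. -/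
def nbhd {N : ℕ} (x : Point Ax N) : Filter (Point Ax N) where
  sets := {S | ∃ n, ∀ y, near n x y → y ∈ S}
  univ_sets := ⟨0, fun _ _ => trivial⟩
  sets_of_superset := fun ⟨n, hn⟩ h => ⟨n, fun y hy => h (hn y hy)⟩
  inter_sets := fun ⟨n, hn⟩ ⟨m, hm⟩ => ⟨max n m, fun y hy =>
    ⟨hn y (near_anti (le_max_left _ _) hy), hm y (near_anti (le_max_right _ _) hy)⟩⟩

theorem exists_near {N : ℕ} (n : ℕ) (x : Point Ax N) {v : World Ax N}
    (h : World.Rel x.1.1 v) : ∃ y : Point Ax N, near n x y ∧ y.1.1 = v := by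
  refine ⟨⟨(v, fun i => if i < n then x.1.2 i else v.lev), fun i => ?_, n, by simp⟩,
    ⟨fun i hi => by simp [hi], h⟩, rfl⟩
  dsimp only
  split_ifs
  · exact (x.2.1 i).trans h.1
  · exact le_rfl

/-- the individual denoted at `x` by an element of the constant domain `ℕ × ℕ`. -/
noncomputable def indiv {N : ℕ} (x : Point Ax N) (a : ℕ × ℕ) : ℕ :=
  if a.2 ∈ dom N (x.1.2 a.1) then a.2 else Nat.pair 0 N

theorem indiv_mem {N : ℕ} (x : Point Ax N) (a : ℕ × ℕ) : indiv x a ∈ dom N x.1.1.lev := by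
  unfold indiv
  split_ifs with h
  · exact dom_mono (x.2.1 a.1) h
  · exact dom_mono (Nat.zero_le _) (pair_mem_dom le_rfl)

theorem exists_indiv_eq {N : ℕ} (x : Point Ax N) {d : ℕ} (hd : d ∈ dom N x.1.1.lev) :
    ∃ a, indiv x a = d := by
  obtain ⟨i, hi⟩ := x.2.2
  exact ⟨(i, d), if_pos (by simpa [hi] using hd)⟩

theorem indiv_eq_of_near {N n : ℕ} {x y : Point Ax N} (h : near n x y) {a : ℕ × ℕ}
    (ha : a.1 < n) : indiv y a = indiv x a := by
  simp only [indiv, h.1 _ ha]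

/-- the canonical interpretation of the predicate letters. -/
def interp {N : ℕ} (k n : ℕ) (x : Point Ax N) (args : Fin n → ℕ × ℕ) : Prop :=
  PF.pred k n (fun i => indiv x (args i)) ∈ x.1.1.carrier

theorem simSub_mem_Lang {N : ℕ} {A : PF} (hA : BoundLt N A) (x : Point Ax N)
    (env : ℕ → ℕ × ℕ) : simSub (fun i => indiv x (env i)) A ∈ Lang N x.1.1.lev := by
  refine ⟨boundLt_simSub hA, fun v hv => ?_⟩
  obtain ⟨y, -, rfl⟩ := freeIn_simSub hv
  exact indiv_mem x _

theorem simSub_indiv_near {N : ℕ} (A : PF) (x : Point Ax N) (env : ℕ → ℕ × ℕ) :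
    ∃ n, ∀ y, near n x y →
      simSub (fun i => indiv y (env i)) A = simSub (fun i => indiv x (env i)) A := by
  obtain ⟨m, hm⟩ := exists_freeIn_lt A
  refine ⟨(Finset.range m).sup (fun i => (env i).1 + 1), fun y hy => simSub_congr fun v hv => ?_⟩
  exact indiv_eq_of_near hy
    (Finset.le_sup (f := fun i => (env i).1 + 1) (Finset.mem_range.2 (hm v hv)))

theorem truth {N : ℕ} {A : PF} (hA : BoundLt N A) : ∀ (env : ℕ → ℕ × ℕ) (x : Point Ax N),
    pnsat nbhd interp env x A ↔ simSub (fun i => indiv x (env i)) A ∈ x.1.1.carrier := by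
  induction A with
  | falsum => exact fun env x => ⟨False.elim, fun h => x.1.1.cons (.hyp h)⟩
  | pred k n args => exact fun env x => Iff.rfl
  | impl A B ihA ihB =>
    intro env x
    simp only [pnsat, simSub]
    rw [x.1.1.impl_mem_iff (simSub_mem_Lang hA.1 x env) (simSub_mem_Lang hA.2 x env),
      ihA hA.1, ihB hA.2]
  | box A ih =>
    intro env x
    simp only [pnsat, simSub]
    rw [x.1.1.box_mem_iff (simSub_mem_Lang (A := A) hA x env)]
    obtain ⟨n, hn⟩ := simSub_indiv_near A x env
    constructor
    · rintro ⟨U, ⟨m, hm⟩, hU⟩ v hv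
      obtain ⟨y, hy, rfl⟩ := exists_near (max n m) x hv
      rw [← hn y (near_anti (le_max_left _ _) hy)]
      exact (ih hA env y).1 (hU y (hm y (near_anti (le_max_right _ _) hy)))
    · refine fun h => ⟨{y | near n x y}, ⟨n, fun y hy => hy⟩, fun y hy => (ih hA env y).2 ?_⟩
      rw [hn y hy]
      exact h _ hy.2
  | all z A ih =>
    intro env x
    have hL := simSub_mem_Lang hA x env
    simp only [pnsat, simSub] at hL ⊢
    have hz : ∀ y, y ≠ z → indiv x (env y) ≠ z := fun y _ h => by
      have h1 := (indiv_mem x (env y)).1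
      have h2 := hA.1
      omega
    have hup : ∀ a, (fun i => indiv x (Function.update env z a i)) =
        Function.update (fun i => indiv x (env i)) z (indiv x a) := fun a => by
      funext i
      by_cases hi : i = z
      · subst hi
        simp
      · simp [Function.update_of_ne hi]
    rw [x.1.1.all_mem_iff hL]
    constructor
    · intro h d hd
      obtain ⟨a, rfl⟩ := exists_indiv_eq x hd
      rw [subV_simSub hz, ← hup]
      exact (ih hA.2 _ x).1 (h a)
    · intro h a
      rw [ih hA.2, hup, ← subV_simSub hz]
      exact h _ (indiv_mem x a)

/- ### Soundness -/

section Soundness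

variable {X D : Type} {τ : X → Filter X}

theorem nbsat_substMF {V : ℕ → Set X} {σ : ℕ → MF} {A : MF} : ∀ x,
    nbsat τ V x (substMF σ A) ↔ nbsat τ (fun n => {y | nbsat τ V y (σ n)}) x A := by
  induction A with
  | falsum => exact fun _ => Iff.rfl
  | prop n => exact fun _ => Iff.rfl
  | impl A B ihA ihB => intro x; simp only [substMF, nbsat, ihA, ihB]
  | box A ih => intro x; simp only [substMF, nbsat, ih]

theorem nbsat_of_taut {V : ℕ → Set X} {A : MF} (x : X) :
    beval (fun n => x ∈ V n) (fun B => nbsat τ V x (.box B)) A ↔ nbsat τ V x A := by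
  induction A with
  | falsum => exact Iff.rfl
  | prop n => exact Iff.rfl
  | impl A B ihA ihB => exact imp_congr ihA ihB
  | box A _ => exact Iff.rfl

theorem KDer.sound (hAx : ∀ A ∈ Ax, A ∈ NLog τ) {A : MF} (h : KDer Ax A) : A ∈ NLog τ := by
  induction h with
  | ax h => exact hAx _ h
  | taut h => exact fun V x => (nbsat_of_taut x).1 (h _ _)
  | normality A B =>
    rintro V x ⟨U, hU, h⟩ ⟨U', hU', h'⟩
    exact ⟨U ∩ U', Filter.inter_mem hU hU', fun y hy => h y hy.1 (h' y hy.2)⟩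
  | mp _ _ ih1 ih2 => exact fun V x => ih1 V x (ih2 V x)
  | nec _ ih => exact fun V x => ⟨Set.univ, Filter.univ_mem, fun y _ => ih V y⟩
  | subst σ _ ih => exact fun V x => (nbsat_substMF x).2 (ih _ x)

theorem nbsat_closed {A : MF} (hA : ClosedMF A) {V V' : ℕ → Set X} : ∀ x,
    nbsat τ V x A ↔ nbsat τ V' x A := by
  induction A with
  | falsum => exact fun _ => Iff.rfl
  | prop n => exact hA.elim
  | impl A B ihA ihB => intro x; simp only [nbsat, ihA hA.1, ihB hA.2]
  | box A ih => intro x; simp only [nbsat, ih hA]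

variable {θ : ℕ → (n : ℕ) → X → (Fin n → D) → Prop}

theorem pnsat_psubst {env : ℕ → D} {σ : ℕ → PF} {A : MF} : ∀ x,
    pnsat τ θ env x (psubst σ A) ↔ nbsat τ (fun n => {y | pnsat τ θ env y (σ n)}) x A := by
  induction A with
  | falsum => exact fun _ => Iff.rfl
  | prop n => exact fun _ => Iff.rfl
  | impl A B ihA ihB => intro x; simp only [psubst, pnsat, nbsat, ihA, ihB]
  | box A ih => intro x; simp only [psubst, pnsat, nbsat, ih]

theorem pnsat_congr {A : PF} : ∀ {env env' : ℕ → D} (_ : ∀ v, FreeIn v A → env v = env' v)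
    (x : X), pnsat τ θ env x A ↔ pnsat τ θ env' x A := by
  induction A with
  | falsum => exact fun _ _ => Iff.rfl
  | pred k n args =>
    intro env env' h x
    simp only [pnsat]
    rw [show (fun i => env (args i)) = fun i => env' (args i) from
      funext fun i => h _ ⟨i, rfl⟩]
  | impl A B ihA ihB =>
    intro env env' h x
    simp only [pnsat]
    rw [ihA (fun v hv => h v (Or.inl hv)), ihB (fun v hv => h v (Or.inr hv))]
  | box A ih =>
    intro env env' h x
    simp only [pnsat, ih h]
  | all z A ih =>
    intro env env' h x
    simp only [pnsat]
    refine forall_congr' fun a => ih (fun v hv => ?_) x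
    by_cases hz : v = z
    · simp [hz]
    · simp [Function.update_of_ne hz, h v ⟨fun h => hz h.symm, hv⟩]

theorem pnsat_update_of_not_freeIn {A : PF} {v : ℕ} (h : ¬ FreeIn v A) {env : ℕ → D} {a : D}
    (x : X) : pnsat τ θ (Function.update env v a) x A ↔ pnsat τ θ env x A :=
  pnsat_congr (fun u hu => Function.update_of_ne (fun huv : u = v => h (huv ▸ hu)) _ _) x

theorem pnsat_subV {v u : ℕ} {A : PF} (h : FreeFor u v A) : ∀ (env : ℕ → D) (x : X),
    pnsat τ θ env x (subV v u A) ↔ pnsat τ θ (Function.update env v (env u)) x A := by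
  induction A with
  | falsum => exact fun _ _ => Iff.rfl
  | pred k n args =>
    intro env x
    simp only [pnsat, subV]
    rw [show (fun i => env (if args i = v then u else args i)) =
      fun i => Function.update env v (env u) (args i) from funext fun i => by
        by_cases hi : args i = v
        · simp [hi]
        · simp [hi]]
  | impl A B ihA ihB =>
    intro env x
    simp only [pnsat, subV, ihA h.1, ihB h.2]
  | box A ih =>
    intro env x
    simp only [pnsat, subV, ih h]
  | all z A ih =>
    intro env x
    by_cases hz : z = v
    · rw [show subV v u (.all z A) = .all z A by simp only [subV, if_pos hz]]
      exact (pnsat_update_of_not_freeIn (A := .all z A) (fun h => h.1 hz) x).symm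
    · obtain ⟨hcap, hff⟩ := h.resolve_left fun h => hz h.symm
      simp only [subV, if_neg hz, pnsat]
      refine forall_congr' fun a => ?_
      rw [ih hff, ← Function.update_comm hz]
      by_cases hzu : z = u
      · rw [pnsat_update_of_not_freeIn (hcap hzu), pnsat_update_of_not_freeIn (hcap hzu)]
      · rw [Function.update_of_ne (Ne.symm hzu)]

end Soundness

theorem QLDer.sound {F : PredNFrame} (hAx : ∀ A ∈ Ax, A ∈ NLog F.tau) {A : PF}
    (h : QLDer Ax A) : F.Valid A := by
  induction h with
  | propInst σ h => exact fun θ env x => (pnsat_psubst x).2 (KDer.sound hAx h _ x)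
  | allElim v u A h => exact fun θ env x hall => (pnsat_subV h env x).2 (hall (env u))
  | allShift v A B h =>
    exact fun θ env x hall hB a => hall a ((pnsat_update_of_not_freeIn h x).2 hB)
  | exShift v A B h =>
    intro θ env x hall hex
    by_contra hB
    exact hex fun a hA => hB ((pnsat_update_of_not_freeIn h x).1 (hall a hA))
  | mp _ _ ih1 ih2 => exact fun θ env x => ih1 θ env x (ih2 θ env x)
  | nec _ ih => exact fun θ env x => ⟨Set.univ, Filter.univ_mem, fun y _ => ih θ env y⟩
  | gen v _ ih => exact fun θ env x a => ih θ _ x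

/- ### Validity of the axioms on the canonical neighbourhood frame -/

theorem nbsat_boxIter {N n : ℕ} {V : ℕ → Set (Point Ax N)} {k : ℕ} : ∀ {A : MF}
    {x : Point Ax N}, (∀ y, relIter (near n) k x y → nbsat nbhd V y A) →
      nbsat nbhd V x (boxIter k A) := by
  induction k with
  | zero => exact fun h => h _ rfl
  | succ k ih =>
    exact fun h => ih fun y hy => ⟨{z | near n y z}, ⟨n, fun z hz => hz⟩,
      fun z hz => h z ⟨y, hy, hz⟩⟩

theorem relIter_near {N n k : ℕ} {x y : Point Ax N} (h : relIter (near n) k x y) :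
    (∀ i < n, y.1.2 i = x.1.2 i) ∧ relIter World.Rel k x.1.1 y.1.1 := by
  induction k generalizing y with
  | zero =>
    obtain rfl : x = y := h
    exact ⟨fun _ _ => rfl, rfl⟩
  | succ k ih =>
    obtain ⟨u, hu, huy⟩ := h
    obtain ⟨h1, h2⟩ := ih hu
    exact ⟨fun i hi => (huy.1 i hi).trans (h1 i hi), _, h2, huy.2⟩

theorem ptcAxiom_valid {N k : ℕ} (hk : ptcAxiom k ∈ Ax) :
    ptcAxiom k ∈ NLog (nbhd : Point Ax N → _) := by
  rintro V x ⟨U, ⟨n, hn⟩, hU⟩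
  refine nbsat_boxIter (n := n) fun y hy => hU y (hn y ?_)
  obtain ⟨h1, h2⟩ := relIter_near hy
  exact ⟨h1, rel_of_relIter hk h2⟩

theorem psubst_falsum_variableFree (A : MF) :
    BoundLt 0 (psubst (fun _ => .falsum) A) ∧
      ∀ v, ¬ FreeIn v (psubst (fun _ => .falsum) A) := by
  induction A with
  | falsum => exact ⟨trivial, fun _ h => h⟩
  | prop n => exact ⟨trivial, fun _ h => h⟩
  | impl A B ihA ihB =>
    exact ⟨⟨ihA.1, ihB.1⟩, fun v h => h.elim (ihA.2 v) (ihB.2 v)⟩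
  | box A ih => exact ih

theorem closed_valid {N : ℕ} {A : MF} (hA : A ∈ Ax) (hcl : ClosedMF A) :
    A ∈ NLog (nbhd : Point Ax N → _) := by
  intro V x
  obtain ⟨hb, hf⟩ := psubst_falsum_variableFree A
  have hb := hb.mono (Nat.zero_le N)
  have h : pnsat nbhd interp (fun _ => (0, 0)) x (psubst (fun _ => .falsum) A) := by
    rw [truth hb]
    refine x.1.1.mem_of_prov (simSub_mem_Lang hb x _) (.thm ?_)
    rw [simSub_congr (e' := id) fun v hv => (hf v hv).elim, simSub_id]
    exact .propInst _ (.ax hA)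
  exact (nbsat_closed hcl x).1 ((pnsat_psubst x).1 h)

/- ### Refutation of non-theorems -/

/-- universal closure with respect to the variables below `n`. -/
def closure (A : PF) : ℕ → PF
  | 0 => A
  | n + 1 => .all n (closure A n)

theorem boundLt_closure {N : ℕ} {A : PF} (hA : BoundLt N A) {n : ℕ} (hn : n ≤ N) :
    BoundLt N (closure A n) := by
  induction n with
  | zero => exact hA
  | succ n ih => exact ⟨hn, ih (by omega)⟩

theorem freeIn_closure {A : PF} {n v : ℕ} (h : FreeIn v (closure A n)) : n ≤ v ∧ FreeIn v A := by
  induction n with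
  | zero => exact ⟨Nat.zero_le _, h⟩
  | succ n ih =>
    obtain ⟨h1, h2⟩ := ih h.2
    exact ⟨lt_of_le_of_ne h1 h.1, h2⟩

theorem QLDer.of_closure {A : PF} {n : ℕ} (h : QLDer Ax (closure A n)) : QLDer Ax A := by
  induction n with
  | zero => exact h
  | succ n ih =>
    refine ih ?_
    have h1 := QLDer.allElim (Ax := Ax) n n (closure A n) (freeFor_self _ _)
    rw [subV_self] at h1
    exact .mp h1 h

theorem pnsat_closure {X D : Type} {τ : X → Filter X}
    {θ : ℕ → (n : ℕ) → X → (Fin n → D) → Prop} {A : PF} {x : X}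
    (h : ∀ env, pnsat τ θ env x A) (n : ℕ) : ∀ env, pnsat τ θ env x (closure A n) := by
  induction n with
  | zero => exact h
  | succ n ih => exact fun env a => ih _

theorem exists_refutation {A : PF} (hA : ¬ QLDer Ax A) :
    ∃ (N : ℕ) (env : ℕ → ℕ × ℕ) (x : Point Ax N), ¬ pnsat nbhd interp env x A := by
  obtain ⟨n, hn⟩ := exists_boundLt A
  obtain ⟨m, hm⟩ := exists_freeIn_lt A
  set N := max n m
  have hb : BoundLt N (closure A N) := boundLt_closure (hn.mono (le_max_left _ _)) le_rfl
  have hf : ∀ v, ¬ FreeIn v (closure A N) := fun v hv => by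
    obtain ⟨h1, h2⟩ := freeIn_closure hv
    exact absurd (hm v h2) (not_lt.2 ((le_max_right _ _).trans h1))
  have hL : closure A N ∈ Lang N 0 := ⟨hb, fun v hv => (hf v hv).elim⟩
  obtain ⟨w, -, hw⟩ := exists_world (Ax := Ax) (N := N) (k := 0) (Γ := insert (negPF (closure A N)) ∅)
    (Set.insert_subset (negPF_mem_Lang hL) (Set.empty_subset _))
    fun h => hA (QLDer.of_closure h.by_contra.of_empty)
  let x : Point Ax N := ⟨(w, fun _ => w.lev), fun _ => le_rfl, 0, rfl⟩
  by_contra hcon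
  push Not at hcon
  have h := (truth hb _ x).1 (pnsat_closure (fun env => hcon N env x) N fun _ => (0, 0))
  rw [simSub_congr (e' := id) fun v hv => (hf v hv).elim, simSub_id] at h
  exact w.not_mem_of_neg (hw (Set.mem_insert _ _)) h

/-- the canonical predicate neighbourhood frame. -/
def frame (Ax : Set MF) (N : ℕ) : PredNFrame where
  X := Point Ax N
  tau := nbhd
  D := ℕ × ℕ
  hD := inferInstance

theorem frame_valid {C : Set MF} (hC : ∀ A ∈ C, ClosedMF A) {K : Set ℕ} (N : ℕ) {B : PF}
    (hB : QLDer (C ∪ ptcAxiomSet K) B) : (frame (C ∪ ptcAxiomSet K) N).Valid B := by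
  refine QLDer.sound (fun A hA => ?_) hB
  rcases hA with hA | ⟨k, hk, rfl⟩
  · exact closed_valid (Or.inl hA) (hC A hA)
  · exact ptcAxiom_valid (Or.inr ⟨k, hk, rfl⟩)

end QLCompleteness

/-- completeness of `QL` for a one-way PTC-logic `L` with respect to
predicate neighbourhood frames with constant domains: `QL` is the logic of some
class of such frames; equivalently, every formula not in `QL` is refuted in a
predicate neighbourhood model with constant domain whose frame validates `QL`. -/
theorem QL_complete_pred_nbhd_frames
    (C : Set MF) (hC : ∀ A ∈ C, ClosedMF A) (K : Set ℕ)
    (QL : Set PF) (hQL : QL = {A | QLDer (C ∪ ptcAxiomSet K) A}) :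
    (∃ 𝒞 : Set PredNFrame, ∀ A : PF, A ∈ QL ↔ ∀ F ∈ 𝒞, F.Valid A) ∧
    (∀ A : PF, A ∉ QL →
      ∃ F : PredNFrame, (∀ B ∈ QL, F.Valid B) ∧
        ∃ (θ : ℕ → (n : ℕ) → F.X → (Fin n → F.D) → Prop)
          (env : ℕ → F.D) (x : F.X),
          ¬ pnsat F.tau θ env x A) := by
  subst hQL
  have refute : ∀ A : PF, A ∉ {A | QLDer (C ∪ ptcAxiomSet K) A} →
      ∃ F : PredNFrame, (∀ B ∈ {A | QLDer (C ∪ ptcAxiomSet K) A}, F.Valid B) ∧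
        ∃ (θ : ℕ → (n : ℕ) → F.X → (Fin n → F.D) → Prop)
          (env : ℕ → F.D) (x : F.X),
          ¬ pnsat F.tau θ env x A := by
    intro A hA
    obtain ⟨N, env, x, h⟩ := QLCompleteness.exists_refutation hA
    exact ⟨QLCompleteness.frame _ N, fun B hB => QLCompleteness.frame_valid hC N hB,
      QLCompleteness.interp, env, x, h⟩
  refine ⟨⟨{F | ∀ B ∈ {A | QLDer (C ∪ ptcAxiomSet K) A}, F.Valid B}, fun A =>
    ⟨fun hA F hF => hF A hA, fun h => ?_⟩⟩, refute⟩
  by_contra hA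
  obtain ⟨F, hF, θ, env, x, hx⟩ := refute A hA
  exact hx (h F hF θ env x)
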